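/- Let f : ℝ → ℝ be integrable and of exponential order, and let F(x,t) = (f*G_{√t})(x) be the associated heat-equation solution. Then F_xx has no isolated zeros in the open upper half-plane: if F_xx(x₀, t₀) = 0 with t₀ > 0, then for every ε > 0 there exists a point (x,t) ≠ (x₀,t₀) with t > 0, |x−x₀| < ε, |t−t₀| < ε, and F_xx(x,t) = 0. -/

import Mathlib

open MeasureTheory Real Filter Topology

noncomputable section

/-- `f : ℝ → ℝ` is integrable and of exponential order. -/
def ExpOrder1 (f : ℝ → ℝ) : Prop :=
  Integrable f ∧ ∃ C γ : ℝ, 0 < C ∧ 0 < γ ∧ ∀ᵐ x : ℝ, |f x| ≤ C * Real.exp (-γ * |x|)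

/-- The Gaussian kernel `G_σ(x) = (2πσ²)^{-1/2} e^{-x²/(2σ²)}`. -/
def gaussK (σ x : ℝ) : ℝ := (Real.sqrt (2 * Real.pi * σ ^ 2))⁻¹ * Real.exp (-x ^ 2 / (2 * σ ^ 2))

/-- The heat-equation solution `F(x,t) = (f * G_{√t})(x)` with initial datum `f`. -/
def heatSol (f : ℝ → ℝ) (x t : ℝ) : ℝ := ∫ y, f y * gaussK (Real.sqrt t) (x - y)

/-- `F_xx`, the second partial derivative of the heat solution in `x`. -/
def heatSolXX (f : ℝ → ℝ) (x t : ℝ) : ℝ := iteratedDeriv 2 (fun x' => heatSol f x' t) x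

/-! ### Calculus at minima and the weak minimum principle -/

/-- The second derivative is nonnegative at a local minimum. -/
theorem IsLocalMin.hasDerivAt_hasDerivAt_nonneg {g g' : ℝ → ℝ} {x c : ℝ} (hmin : IsLocalMin g x)
    (hg : ∀ z, HasDerivAt g (g' z) z) (hg' : HasDerivAt g' c x) : 0 ≤ c := by
  by_contra! hc
  have hd : deriv g = g' := funext fun z => (hg z).deriv
  have hmax : IsLocalMax g x :=
    isLocalMax_of_deriv_deriv_neg (by rw [hd, hg'.deriv]; exact hc) hmin.deriv_eq_zero
      (hg x).continuousAt
  have hconst : g =ᶠ[𝓝 x] fun _ => g x := by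
    filter_upwards [hmin, hmax] with z h1 h2 using le_antisymm h2 h1
  have hzero : g' =ᶠ[𝓝 x] fun _ => 0 := by
    have := hconst.deriv
    rwa [hd, deriv_const'] at this
  exact hc.ne (hg'.unique ((hasDerivAt_const x (0 : ℝ)).congr_of_eventuallyEq hzero))

/-- The derivative is nonpositive at a point where a function is minimal from the left. -/
theorem HasDerivAt.nonpos_of_eventually_left_ge {g : ℝ → ℝ} {c s : ℝ} (hg : HasDerivAt g c s)
    (hmin : ∀ᶠ r in 𝓝[<] s, g s ≤ g r) : c ≤ 0 := by
  have hsub : 𝓝[<] s ≤ 𝓝[≠] s := nhdsWithin_mono s fun r (hr : r < s) => hr.ne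
  refine le_of_tendsto (hg.tendsto_slope.mono_left hsub) ?_
  filter_upwards [hmin, self_mem_nhdsWithin] with r h1 h2
  rw [slope_def_field]
  exact div_nonpos_of_nonneg_of_nonpos (sub_nonneg.2 h1) (sub_nonpos.2 (le_of_lt h2))

/-- **Weak minimum principle** for strict supersolutions of the heat equation: on a rectangle, the
minimum is attained on the parabolic boundary. -/
theorem heat_strict_weak_min {u ux uxx ut : ℝ → ℝ → ℝ} {a b t₁ t₂ m : ℝ}
    (hcont : ContinuousOn (Function.uncurry u) (Set.Icc a b ×ˢ Set.Icc t₁ t₂))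
    (hx : ∀ x, ∀ t ∈ Set.Ioc t₁ t₂, HasDerivAt (fun z => u z t) (ux x t) x)
    (hxx : ∀ x, ∀ t ∈ Set.Ioc t₁ t₂, HasDerivAt (fun z => ux z t) (uxx x t) x)
    (ht : ∀ x, ∀ t ∈ Set.Ioc t₁ t₂, HasDerivAt (fun s => u x s) (ut x t) t)
    (hsuper : ∀ x, ∀ t ∈ Set.Ioc t₁ t₂, uxx x t / 2 < ut x t)
    (hbot : ∀ x ∈ Set.Icc a b, m ≤ u x t₁)
    (hleft : ∀ t ∈ Set.Icc t₁ t₂, m ≤ u a t) (hright : ∀ t ∈ Set.Icc t₁ t₂, m ≤ u b t)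
    {x t : ℝ} (hxm : x ∈ Set.Icc a b) (htm : t ∈ Set.Icc t₁ t₂) : m ≤ u x t := by
  obtain ⟨⟨p, q⟩, ⟨hp, hq⟩, hmin⟩ :=
    (isCompact_Icc.prod isCompact_Icc).exists_isMinOn ⟨(x, t), hxm, htm⟩ hcont
  have hle : ∀ y ∈ Set.Icc a b, ∀ s ∈ Set.Icc t₁ t₂, u p q ≤ u y s :=
    fun y hy s hs => hmin (Set.mk_mem_prod hy hs)
  refine le_trans ?_ (hle x hxm t htm)
  simp only at hp hq
  rcases hq.1.eq_or_lt with rfl | hq1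
  · exact hbot p hp
  rcases hp.1.eq_or_lt with rfl | hp1
  · exact hleft q hq
  rcases hp.2.eq_or_lt with rfl | hp2
  · exact hright q hq
  have hq' : q ∈ Set.Ioc t₁ t₂ := ⟨hq1, hq.2⟩
  have h1 : 0 ≤ uxx p q := by
    refine IsLocalMin.hasDerivAt_hasDerivAt_nonneg (g := fun z => u z q) ?_
      (fun z => hx z q hq') (hxx p q hq')
    filter_upwards [Icc_mem_nhds hp1 hp2] with y hy using hle y hy q hq
  have h2 : ut p q ≤ 0 := by
    refine (ht p q hq').nonpos_of_eventually_left_ge ?_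
    filter_upwards [Ioo_mem_nhdsLT hq1] with s hs
    exact hle p hp s ⟨hs.1.le, hs.2.le.trans hq.2⟩
  linarith [hsuper p q hq']

/-- A continuous function without zeros on a preconnected set, positive at one point, is positive
everywhere on the set. -/
theorem IsPreconnected.pos_of_ne_zero {X : Type*} [TopologicalSpace X] {s : Set X}
    (hs : IsPreconnected s) {g : X → ℝ} (hg : ContinuousOn g s) (hne : ∀ p ∈ s, g p ≠ 0)
    {p : X} (hp : p ∈ s) (hpos : 0 < g p) {q : X} (hq : q ∈ s) : 0 < g q := by
  by_contra! h
  obtain ⟨r, hr, hr0⟩ := hs.intermediate_value hq hp hg ⟨h, hpos.le⟩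
  exact hne r hr hr0

/-- The parabolic boundary of the rectangle `[a, b] × [t₁, t₂]`. -/
def parabolicBoundary (a b t₁ t₂ : ℝ) : Set (ℝ × ℝ) :=
  (Set.Icc a b ×ˢ {t₁}) ∪ ({a} ×ˢ Set.Icc t₁ t₂) ∪ ({b} ×ˢ Set.Icc t₁ t₂)

theorem parabolicBoundary_subset {a b t₁ t₂ : ℝ} (hab : a ≤ b) (h12 : t₁ ≤ t₂) :
    parabolicBoundary a b t₁ t₂ ⊆ Set.Icc a b ×ˢ Set.Icc t₁ t₂ := by
  rintro ⟨x, t⟩ ((⟨h1, h2⟩ | ⟨h1, h2⟩) | ⟨h1, h2⟩) <;> simp only [Set.mem_singleton_iff] at h1 h2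
  · exact ⟨h1, by simp [h2, h12]⟩
  · exact ⟨by simp [h1, hab], h2⟩
  · exact ⟨by simp [h1, hab], h2⟩

theorem isCompact_parabolicBoundary (a b t₁ t₂ : ℝ) : IsCompact (parabolicBoundary a b t₁ t₂) :=
  ((isCompact_Icc.prod isCompact_singleton).union (isCompact_singleton.prod isCompact_Icc)).union
    (isCompact_singleton.prod isCompact_Icc)

theorem isPreconnected_parabolicBoundary {a b t₁ t₂ : ℝ} (hab : a ≤ b) (h12 : t₁ ≤ t₂) :
    IsPreconnected (parabolicBoundary a b t₁ t₂) := by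
  refine IsPreconnected.union (b, t₁) (Or.inl ⟨⟨hab, le_rfl⟩, rfl⟩) ⟨rfl, le_rfl, h12⟩
    (IsPreconnected.union (a, t₁) ⟨⟨le_rfl, hab⟩, rfl⟩ ⟨rfl, le_rfl, h12⟩ ?_ ?_) ?_
  · exact isPreconnected_Icc.prod isPreconnected_singleton
  · exact isPreconnected_singleton.prod isPreconnected_Icc
  · exact isPreconnected_singleton.prod isPreconnected_Icc

/-- A solution of the heat equation which is positive on the parabolic boundary of a rectangle is
positive on the rectangle. -/
theorem heat_pos_of_pos_parabolicBoundary {u ux uxx : ℝ → ℝ → ℝ} {a b t₁ t₂ : ℝ}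
    (hcont : ContinuousOn (Function.uncurry u) (Set.Icc a b ×ˢ Set.Icc t₁ t₂))
    (hx : ∀ x, ∀ t ∈ Set.Ioc t₁ t₂, HasDerivAt (fun z => u z t) (ux x t) x)
    (hxx : ∀ x, ∀ t ∈ Set.Ioc t₁ t₂, HasDerivAt (fun z => ux z t) (uxx x t) x)
    (ht : ∀ x, ∀ t ∈ Set.Ioc t₁ t₂, HasDerivAt (fun s => u x s) (uxx x t / 2) t)
    (hpos : ∀ p ∈ parabolicBoundary a b t₁ t₂, 0 < u p.1 p.2)
    {x t : ℝ} (hxm : x ∈ Set.Icc a b) (htm : t ∈ Set.Icc t₁ t₂) : 0 < u x t := by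
  have hab := hxm.1.trans hxm.2
  have h12 := htm.1.trans htm.2
  obtain ⟨p, hp, hmin⟩ := (isCompact_parabolicBoundary a b t₁ t₂).exists_isMinOn
    ⟨(a, t₁), Or.inl (Or.inl ⟨⟨le_rfl, hab⟩, rfl⟩)⟩
    (hcont.mono (parabolicBoundary_subset hab h12))
  have hle : ∀ y s, (y, s) ∈ parabolicBoundary a b t₁ t₂ → u p.1 p.2 ≤ u y s :=
    fun y s h => hmin h
  have hm : 0 < u p.1 p.2 := hpos p hp
  obtain ⟨δ, hδ, hδm⟩ : ∃ δ > 0, δ * (t - t₁) < u p.1 p.2 := by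
    have ht1 : 0 < t - t₁ + 1 := by linarith [htm.1]
    refine ⟨u p.1 p.2 / (t - t₁ + 1), div_pos hm ht1, ?_⟩
    rw [div_mul_eq_mul_div, div_lt_iff₀ ht1]
    nlinarith
  have key : u p.1 p.2 ≤ u x t + δ * (t - t₁) := by
    refine heat_strict_weak_min (u := fun x t => u x t + δ * (t - t₁)) (ux := ux) (uxx := uxx)
      (ut := fun x t => uxx x t / 2 + δ) ?_ ?_ hxx ?_ ?_ ?_ ?_ ?_ hxm htm
    · exact hcont.add (by fun_prop)
    · exact fun x t h => (hx x t h).add_const _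
    · intro x t h
      exact ((ht x t h).add (((hasDerivAt_id t).sub_const t₁).const_mul δ)).congr_deriv (by simp)
    · intro x t _
      linarith
    · intro y hy
      simpa using hle y t₁ (Or.inl (Or.inl ⟨hy, rfl⟩))
    · intro s hs
      nlinarith [hle a s (Or.inl (Or.inr ⟨rfl, hs⟩)), hs.1]
    · intro s hs
      nlinarith [hle b s (Or.inr ⟨rfl, hs⟩), hs.1]
  linarith

/-! ### Gaussian moments of an integrable function -/

/-- The kernel `zᵏ e^{-z²/(2t)}`. -/
def gaussMonomial (k : ℕ) (z t : ℝ) : ℝ := z ^ k * Real.exp (-z ^ 2 / (2 * t))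

theorem gaussMonomial_bound (k : ℕ) {b t : ℝ} (ht : 0 < t) (htb : t ≤ b) (z : ℝ) :
    ‖gaussMonomial k z t‖ ≤ 1 + k.factorial * (2 * b) ^ k := by
  have hb : 0 < b := ht.trans_le htb
  set E := Real.exp (-z ^ 2 / (2 * t)) with hE
  have hE1 : E ≤ 1 := Real.exp_le_one_iff.2 (by
    rw [neg_div]; exact neg_nonpos.2 (by positivity))
  have hE2 : (z ^ 2) ^ k * E ≤ k.factorial * (2 * b) ^ k := by
    have h := Real.pow_div_factorial_le_exp (x := z ^ 2 / (2 * t)) (by positivity) k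
    rw [div_le_iff₀ (by positivity), div_pow, div_le_iff₀ (by positivity)] at h
    have hEE : Real.exp (z ^ 2 / (2 * t)) * E = 1 := by
      rw [hE, ← Real.exp_add, neg_div, add_neg_cancel, Real.exp_zero]
    calc (z ^ 2) ^ k * E
        ≤ (Real.exp (z ^ 2 / (2 * t)) * k.factorial * (2 * t) ^ k) * E := by gcongr
      _ = k.factorial * (2 * t) ^ k * (Real.exp (z ^ 2 / (2 * t)) * E) := by ring
      _ ≤ k.factorial * (2 * b) ^ k := by rw [hEE, mul_one]; gcongr
  have hz : |z| ^ k ≤ 1 + (z ^ 2) ^ k := by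
    rw [← sq_abs, ← pow_mul, mul_comm, pow_mul]
    nlinarith [sq_nonneg (|z| ^ k - 1)]
  have hE0 : 0 < E := Real.exp_pos _
  calc ‖gaussMonomial k z t‖ = |z| ^ k * E := by
        rw [gaussMonomial, norm_mul, norm_pow, Real.norm_eq_abs, Real.norm_of_nonneg hE0.le]
    _ ≤ (1 + (z ^ 2) ^ k) * E := by gcongr
    _ ≤ _ := by linarith

theorem continuous_gaussMonomial (k : ℕ) (t : ℝ) : Continuous fun z => gaussMonomial k z t := by
  unfold gaussMonomial
  fun_prop

theorem hasDerivAt_gaussMonomial_left (k : ℕ) (z t : ℝ) :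
    HasDerivAt (fun w => gaussMonomial k w t)
      (k * gaussMonomial (k - 1) z t - gaussMonomial (k + 1) z t / t) z := by
  unfold gaussMonomial
  refine ((hasDerivAt_pow k z).fun_mul
    ((((hasDerivAt_pow 2 z).fun_neg).div_const (2 * t)).exp)).congr_deriv ?_
  rcases eq_or_ne t 0 with rfl | h0
  · simp
  · field_simp
    push_cast
    ring

theorem hasDerivAt_gaussMonomial_right (k : ℕ) (z : ℝ) {t : ℝ} (ht : t ≠ 0) :
    HasDerivAt (fun s => gaussMonomial k z s) (gaussMonomial (k + 2) z t / (2 * t ^ 2)) t := by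
  unfold gaussMonomial
  refine (((((hasDerivAt_id t).const_mul 2).fun_inv (by simpa using ht)).const_mul
    (-z ^ 2)).exp.const_mul (z ^ k)).congr_deriv ?_
  simp only [id, ← div_eq_mul_inv]
  field_simp
  ring

/-- The Gaussian moment `∫ f(y) (x - y)ᵏ e^{-(x-y)²/(2t)} dy`. -/
def gaussMoment (f : ℝ → ℝ) (k : ℕ) (x t : ℝ) : ℝ := ∫ y, f y * gaussMonomial k (x - y) t

theorem aestronglyMeasurable_mul_gaussMonomial {f : ℝ → ℝ} (hf : Integrable f) (k : ℕ) (x t : ℝ) :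
    AEStronglyMeasurable (fun y => f y * gaussMonomial k (x - y) t) :=
  hf.1.mul ((continuous_gaussMonomial k t).comp (by fun_prop)).aestronglyMeasurable

theorem norm_mul_gaussMonomial_le (f : ℝ → ℝ) (k : ℕ) {b t : ℝ} (ht : 0 < t) (htb : t ≤ b)
    (x y : ℝ) :
    ‖f y * gaussMonomial k (x - y) t‖ ≤ ‖f y‖ * (1 + k.factorial * (2 * b) ^ k) := by
  rw [norm_mul]
  gcongr
  exact gaussMonomial_bound k ht htb _

theorem integrable_mul_gaussMonomial {f : ℝ → ℝ} (hf : Integrable f) (k : ℕ) (x : ℝ) {t : ℝ} (ht : 0 < t) :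
    Integrable fun y => f y * gaussMonomial k (x - y) t :=
  (hf.norm.mul_const _).mono' (aestronglyMeasurable_mul_gaussMonomial hf k x t)
    (.of_forall fun y => norm_mul_gaussMonomial_le f k ht le_rfl x y)

theorem continuousAt_gaussMoment {f : ℝ → ℝ} (hf : Integrable f) (k : ℕ) (x : ℝ) {t : ℝ} (ht : 0 < t) :
    ContinuousAt (fun p : ℝ × ℝ => gaussMoment f k p.1 p.2) (x, t) := by
  unfold gaussMoment
  refine continuousAt_of_dominated (F := fun (p : ℝ × ℝ) y => f y * gaussMonomial k (p.1 - y) p.2)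
    (.of_forall fun p => aestronglyMeasurable_mul_gaussMonomial hf k p.1 p.2)
    ?_ (hf.norm.mul_const (1 + k.factorial * (2 * (2 * t)) ^ k)) (.of_forall fun y => ?_)
  · have : ∀ᶠ p : ℝ × ℝ in 𝓝 (x, t), p.2 ∈ Set.Ioo 0 (2 * t) :=
      continuousAt_snd.eventually (Ioo_mem_nhds ht (by simp only; linarith))
    filter_upwards [this] with p hp
    exact .of_forall fun y => norm_mul_gaussMonomial_le f k hp.1 hp.2.le p.1 y
  · unfold gaussMonomial
    have : 2 * (x, t).2 ≠ 0 := by simpa using ht.ne'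
    fun_prop (disch := assumption)

theorem hasDerivAt_gaussMoment_left {f : ℝ → ℝ} (hf : Integrable f) (k : ℕ) (x : ℝ) {t : ℝ} (ht : 0 < t) :
    HasDerivAt (fun z => gaussMoment f k z t)
      (k * gaussMoment f (k - 1) x t - gaussMoment f (k + 1) x t / t) x := by
  have hI := fun j => integrable_mul_gaussMonomial hf j x ht
  have h := (hasDerivAt_integral_of_dominated_loc_of_deriv_le (μ := volume)
    (F := fun z y => f y * gaussMonomial k (z - y) t)
    (F' := fun z y => k * (f y * gaussMonomial (k - 1) (z - y) t) -
      f y * gaussMonomial (k + 1) (z - y) t / t) (x₀ := x) Filter.univ_mem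
    (bound := fun y => k * (‖f y‖ * (1 + (k - 1).factorial * (2 * t) ^ (k - 1))) +
      ‖f y‖ * (1 + (k + 1).factorial * (2 * t) ^ (k + 1)) / t)
    (.of_forall fun z => aestronglyMeasurable_mul_gaussMonomial hf k z t) (hI k)
    (((hI (k - 1)).const_mul _).sub ((hI (k + 1)).div_const _)).1 ?_
    (((hf.norm.mul_const _).const_mul _).add ((hf.norm.mul_const _).div_const _)) ?_).2
  · rw [integral_sub ((hI (k - 1)).const_mul _) ((hI (k + 1)).div_const _),
      integral_const_mul, integral_div] at h
    exact h
  · refine .of_forall fun y z _ => (norm_sub_le _ _).trans ?_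
    rw [norm_mul, norm_div, Real.norm_natCast, Real.norm_of_nonneg ht.le]
    gcongr <;> exact norm_mul_gaussMonomial_le f _ ht le_rfl z y
  · refine .of_forall fun y z _ => ?_
    exact (((hasDerivAt_gaussMonomial_left k (z - y) t).comp_sub_const z y).const_mul
      (f y)).congr_deriv (by ring)

theorem hasDerivAt_gaussMoment_right {f : ℝ → ℝ} (hf : Integrable f) (k : ℕ) (x : ℝ) {t : ℝ} (ht : 0 < t) :
    HasDerivAt (fun s => gaussMoment f k x s) (gaussMoment f (k + 2) x t / (2 * t ^ 2)) t := by
  have hI := integrable_mul_gaussMonomial hf (k + 2) x ht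
  have h := (hasDerivAt_integral_of_dominated_loc_of_deriv_le (μ := volume)
    (F := fun s y => f y * gaussMonomial k (x - y) s)
    (F' := fun s y => f y * gaussMonomial (k + 2) (x - y) s / (2 * s ^ 2)) (x₀ := t)
    (Ioo_mem_nhds (a := t / 2) (b := 2 * t) (by linarith) (by linarith))
    (bound := fun y => ‖f y‖ * (1 + (k + 2).factorial * (2 * (2 * t)) ^ (k + 2)) /
      (2 * (t / 2) ^ 2))
    (.of_forall fun s => aestronglyMeasurable_mul_gaussMonomial hf k x s)
    (integrable_mul_gaussMonomial hf k x ht) (hI.div_const _).1 ?_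
    ((hf.norm.mul_const _).div_const _) ?_).2
  · rwa [integral_div] at h
  · refine .of_forall fun y s hs => ?_
    have hs0 : 0 < s := by linarith [hs.1]
    rw [norm_div, Real.norm_of_nonneg (by positivity : (0 : ℝ) ≤ 2 * s ^ 2)]
    gcongr
    · exact norm_mul_gaussMonomial_le f _ hs0 hs.2.le x y
    · exact hs.1.le
  · refine .of_forall fun y s hs => ?_
    have hs0 : s ≠ 0 := by linarith [hs.1]
    exact ((hasDerivAt_gaussMonomial_right k (x - y) hs0).const_mul (f y)).congr_deriv (by ring)

/-! ### The second derivative of the heat solution -/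

/-- The normalization `(2πt)^{-1/2}` of the heat kernel. -/
def heatNorm (t : ℝ) : ℝ := (Real.sqrt (2 * Real.pi * t))⁻¹

theorem hasDerivAt_heatNorm {t : ℝ} (ht : 0 < t) :
    HasDerivAt heatNorm (-heatNorm t / (2 * t)) t := by
  unfold heatNorm
  have hpos : 0 < 2 * Real.pi * t := by positivity
  refine ((((hasDerivAt_id t).const_mul (2 * Real.pi)).sqrt hpos.ne').fun_inv
    (Real.sqrt_pos.2 hpos).ne').congr_deriv ?_
  simp only [id, Real.sq_sqrt hpos.le]
  field_simp

theorem heatSol_eq (f : ℝ → ℝ) (x : ℝ) {t : ℝ} (ht : 0 < t) :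
    heatSol f x t = heatNorm t * gaussMoment f 0 x t := by
  unfold heatSol heatNorm gaussMoment
  rw [← integral_const_mul]
  congr 1 with y
  rw [gaussK, gaussMonomial, Real.sq_sqrt ht.le]
  ring

theorem heatSolXX_eq {f : ℝ → ℝ} (hf : Integrable f) (x : ℝ) {t : ℝ} (ht : 0 < t) :
    heatSolXX f x t = heatNorm t * (gaussMoment f 2 x t / t ^ 2 - gaussMoment f 0 x t / t) := by
  have h1 : deriv (fun z => heatSol f z t) = fun z => heatNorm t * (-gaussMoment f 1 z t / t) := by
    funext z
    simp only [heatSol_eq f _ ht]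
    rw [((hasDerivAt_gaussMoment_left hf 0 z ht).const_mul (heatNorm t)).deriv]
    simp [-mul_eq_mul_left_iff]
    ring
  rw [heatSolXX, iteratedDeriv_succ, iteratedDeriv_one, h1,
    (((hasDerivAt_gaussMoment_left hf 1 x ht).fun_neg.div_const t).const_mul (heatNorm t)).deriv]
  simp [-mul_eq_mul_left_iff]
  field_simp

/-- The third `x`-derivative of the heat solution, for positive times. -/
def heatSolXXX (f : ℝ → ℝ) (x t : ℝ) : ℝ :=
  heatNorm t * (3 * gaussMoment f 1 x t / t ^ 2 - gaussMoment f 3 x t / t ^ 3)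

/-- The fourth `x`-derivative of the heat solution, for positive times. -/
def heatSolXXXX (f : ℝ → ℝ) (x t : ℝ) : ℝ :=
  heatNorm t * (gaussMoment f 4 x t / t ^ 4 - 6 * gaussMoment f 2 x t / t ^ 3 +
    3 * gaussMoment f 0 x t / t ^ 2)

theorem hasDerivAt_heatSolXX_left {f : ℝ → ℝ} (hf : Integrable f) (x : ℝ) {t : ℝ} (ht : 0 < t) :
    HasDerivAt (fun z => heatSolXX f z t) (heatSolXXX f x t) x := by
  simp only [heatSolXX_eq hf _ ht]
  refine ((((hasDerivAt_gaussMoment_left hf 2 x ht).div_const (t ^ 2)).fun_sub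
    ((hasDerivAt_gaussMoment_left hf 0 x ht).div_const t)).const_mul (heatNorm t)).congr_deriv ?_
  simp [heatSolXXX, -mul_eq_mul_left_iff]
  field_simp
  ring

theorem hasDerivAt_heatSolXXX_left {f : ℝ → ℝ} (hf : Integrable f) (x : ℝ) {t : ℝ} (ht : 0 < t) :
    HasDerivAt (fun z => heatSolXXX f z t) (heatSolXXXX f x t) x := by
  unfold heatSolXXX
  refine (((((hasDerivAt_gaussMoment_left hf 1 x ht).const_mul 3).div_const (t ^ 2)).fun_sub
    ((hasDerivAt_gaussMoment_left hf 3 x ht).div_const (t ^ 3))).const_mul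
      (heatNorm t)).congr_deriv ?_
  simp [heatSolXXXX, -mul_eq_mul_left_iff]
  field_simp
  ring

/-- `F_xx` solves the heat equation. -/
theorem hasDerivAt_heatSolXX_right {f : ℝ → ℝ} (hf : Integrable f) (x : ℝ) {t : ℝ} (ht : 0 < t) :
    HasDerivAt (fun s => heatSolXX f x s) (heatSolXXXX f x t / 2) t := by
  have h := (hasDerivAt_heatNorm ht).mul
    (((hasDerivAt_gaussMoment_right hf 2 x ht).div (hasDerivAt_pow 2 t) (by positivity)).sub
      ((hasDerivAt_gaussMoment_right hf 0 x ht).div (hasDerivAt_id t) ht.ne'))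
  refine (h.congr_of_eventuallyEq
    ((lt_mem_nhds ht).mono fun s hs => heatSolXX_eq hf x hs)).congr_deriv ?_
  simp [heatSolXXXX, -mul_eq_mul_left_iff]
  field_simp
  ring

theorem continuousAt_heatSolXX {f : ℝ → ℝ} (hf : Integrable f) (x : ℝ) {t : ℝ} (ht : 0 < t) :
    ContinuousAt (Function.uncurry (heatSolXX f)) (x, t) := by
  have hN : ContinuousAt (fun p : ℝ × ℝ => heatNorm p.2) (x, t) :=
    ContinuousAt.comp (x := (x, t)) (g := heatNorm) (f := Prod.snd)
      (hasDerivAt_heatNorm ht).continuousAt continuousAt_snd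
  have ht' : (x, t).2 ≠ 0 := ht.ne'
  refine (hN.mul (((continuousAt_gaussMoment hf 2 x ht).div (continuousAt_snd.pow 2)
    (pow_ne_zero 2 ht')).sub ((continuousAt_gaussMoment hf 0 x ht).div continuousAt_snd
      ht'))).congr ?_
  have : ∀ᶠ p : ℝ × ℝ in 𝓝 (x, t), 0 < p.2 := continuousAt_snd.eventually (lt_mem_nhds ht)
  filter_upwards [this] with p hp
  exact (heatSolXX_eq hf p.1 hp).symm

/-- **`F_xx` has no isolated zeros in the open upper half-plane**: any zero of `F_xx` at a
positive time is the limit of other zeros at positive times. -/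
theorem no_isolated_zeros (f : ℝ → ℝ) (hf : ExpOrder1 f)
    (x₀ t₀ : ℝ) (ht₀ : 0 < t₀) (hzero : heatSolXX f x₀ t₀ = 0) :
    ∀ ε > (0 : ℝ), ∃ x t : ℝ, (x, t) ≠ (x₀, t₀) ∧ 0 < t ∧
      |x - x₀| < ε ∧ |t - t₀| < ε ∧ heatSolXX f x t = 0 := by
  intro ε hε
  by_contra! H
  obtain ⟨r, hr, hrε, hrt⟩ : ∃ r > 0, r < ε ∧ r < t₀ :=
    ⟨min ε t₀ / 2, half_pos (lt_min hε ht₀), by linarith [min_le_left ε t₀],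
      by linarith [min_le_right ε t₀]⟩
  have hab : x₀ - r ≤ x₀ + r := by linarith
  have h12 : t₀ - r ≤ t₀ := by linarith
  have hpos12 : ∀ t ∈ Set.Icc (t₀ - r) t₀, 0 < t := fun t ht => by linarith [ht.1]
  have hpos12' : ∀ t ∈ Set.Ioc (t₀ - r) t₀, 0 < t := fun t ht => by linarith [ht.1]
  have hcont : ContinuousOn (Function.uncurry (heatSolXX f))
      (Set.Icc (x₀ - r) (x₀ + r) ×ˢ Set.Icc (t₀ - r) t₀) := fun p hp =>
    (continuousAt_heatSolXX hf.1 p.1 (hpos12 p.2 hp.2)).continuousWithinAt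
  set B := parabolicBoundary (x₀ - r) (x₀ + r) (t₀ - r) t₀
  have hsub := parabolicBoundary_subset hab h12
  have hne : ∀ p ∈ B, Function.uncurry (heatSolXX f) p ≠ 0 := by
    rintro ⟨x, t⟩ hp
    obtain ⟨⟨h1, h2⟩, h3, h4⟩ := hsub hp
    simp only at h1 h2 h3 h4
    refine H x t ?_ (by linarith) (abs_lt.2 ⟨by linarith, by linarith⟩)
      (abs_lt.2 ⟨by linarith, by linarith⟩)
    rintro ⟨rfl, rfl⟩
    rcases hp with (⟨-, h⟩ | ⟨h, -⟩) | ⟨h, -⟩ <;> simp only [Set.mem_singleton_iff] at h <;>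
      linarith
  have hconn := isPreconnected_parabolicBoundary hab h12
  have hmem : (x₀ - r, t₀ - r) ∈ B := Or.inl (Or.inl ⟨⟨le_rfl, hab⟩, rfl⟩)
  have hcB := hcont.mono hsub
  have hx₀ : x₀ ∈ Set.Icc (x₀ - r) (x₀ + r) := ⟨by linarith, by linarith⟩
  have ht₀' : t₀ ∈ Set.Icc (t₀ - r) t₀ := ⟨h12, le_rfl⟩
  rcases (hne _ hmem).lt_or_gt with hneg | hpos
  · have := heat_pos_of_pos_parabolicBoundary (u := fun x t => -heatSolXX f x t)
      (ux := fun x t => -heatSolXXX f x t) (uxx := fun x t => -heatSolXXXX f x t) hcont.neg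
      (fun x t ht => (hasDerivAt_heatSolXX_left hf.1 x (hpos12' t ht)).neg)
      (fun x t ht => (hasDerivAt_heatSolXXX_left hf.1 x (hpos12' t ht)).neg)
      (fun x t ht => (hasDerivAt_heatSolXX_right hf.1 x (hpos12' t ht)).neg.congr_deriv
        (neg_div _ _).symm)
      (fun p hp => hconn.pos_of_ne_zero hcB.neg (fun p hp => neg_ne_zero.2 (hne p hp)) hmem
        (neg_pos.2 hneg) hp) hx₀ ht₀'
    linarith
  · have := heat_pos_of_pos_parabolicBoundary hcont
      (fun x t ht => hasDerivAt_heatSolXX_left hf.1 x (hpos12' t ht))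
      (fun x t ht => hasDerivAt_heatSolXXX_left hf.1 x (hpos12' t ht))
      (fun x t ht => hasDerivAt_heatSolXX_right hf.1 x (hpos12' t ht))
      (fun p hp => hconn.pos_of_ne_zero hcB hne hmem hpos hp) hx₀ ht₀'
    linarith
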